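/- arXiv:1705.08184 — 2 statements merged into one kernel-verified Lean document; each statement's English description precedes it below -/
import Mathlib

section
/- The mapping S_n ↦ S'_n computed by the KSU algorithm is a compression scheme: with C defined on labeled sequences of even length 2m by C((x̄_1,ȳ_1),…,(x̄_{2m},ȳ_{2m})) = ((x̄_1,ȳ_{m+1}),…,(x̄_m,ȳ_{2m})), for every sample S_n the output S'_n equals C(S_n(i)) for a suitable index vector i of length 2|S'_n| (the indices of the γ*-net points followed by indices of sample points whose labels realize the corresponding majority-vote labels); consequently S'_n is a (ê, 2|S'_n|)-compression of S_n, where ê is the empirical error of the 1-NN classifier h_{S'_n} on S_n. -/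
open MeasureTheory Filter Metric Set
open scoped ENNReal NNReal Classical

section NearestNeighbor

variable {X Y : Type*}

/-- `h` is a 1-nearest-neighbor classifier of the finite labeled set `S'`, with respect to the
distance `ρ` (ties broken arbitrarily): every `x` gets the label of some nearest point of `S'`. -/
def Is1NN (ρ : X → X → ℝ) (S' : Finset (X × Y)) (h : X → Y) : Prop :=
  ∀ x : X, ∃ p ∈ S', h x = p.2 ∧ ∀ q ∈ S', ρ x p.1 ≤ ρ x q.1

/-- The empirical error of the classifier `h` on the labeled sample `S`. -/
noncomputable def empErr {n : ℕ} (h : X → Y) (S : Fin n → X × Y) : ℝ :=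
  (Nat.card {i : Fin n // h (S i).1 ≠ (S i).2} : ℝ) / n

/-- `B` is a `γ`-net of `A` with respect to the distance `ρ`: `B ⊆ A`, every point of `A` is
within distance `γ` of `B`, and distinct points of `B` are at distance `> γ`. -/
def IsGNet (ρ : X → X → ℝ) (γ : ℝ) (A B : Set X) : Prop :=
  B ⊆ A ∧ (∀ a ∈ A, ∃ x ∈ B, ρ a x ≤ γ) ∧ ∀ x ∈ B, ∀ y ∈ B, x ≠ y → γ < ρ x y

/-- `v` is a Voronoi assignment for the set of anchors `B`: it maps every point `x` to an
anchor realizing the distance `inf_{p ∈ B} ρ(x, p)`. -/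
def IsVorAssign (ρ : X → X → ℝ) (B : Set X) (v : X → X) : Prop :=
  ∀ x : X, v x ∈ B ∧ ρ x (v x) = ⨅ p : B, ρ x (p : X)

end NearestNeighbor

section KSU

variable {X Y : Type*}

/-- `S'` is obtained from `m = 2k` indexed sample points of `S` via the compression function
`𝒞((x̄_1,ȳ_1),…,(x̄_{2k},ȳ_{2k})) = {(x̄_1, ȳ_{k+1}), …, (x̄_k, ȳ_{2k})}` (the index vector of
length `2k` is recorded as the pair of its two halves `i, i'`). -/
def IsCRepr {n : ℕ} (S : Fin n → X × Y) (m : ℕ) (S' : Finset (X × Y)) : Prop :=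
  ∃ (k : ℕ) (i i' : Fin k → Fin n), m = 2 * k ∧
    S' = Finset.image (fun j : Fin k => ((S (i j)).1, (S (i' j)).2)) Finset.univ

/-- The data `(net, v, lab)` is a valid candidate of the KSU algorithm at scale `γ` for the
sample `S`: `net` is a `γ`-net of the sample points, `v` is a Voronoi assignment for `net`,
and `lab` labels each net point with a label attaining the maximal empirical count among the
sample points lying in its Voronoi cell. -/
def IsKSUCand (ρ : X → X → ℝ) {n : ℕ} (S : Fin n → X × Y) (γ : ℝ)
    (net : Finset X) (v : X → X) (lab : X → Y) : Prop :=
  IsGNet ρ γ {x | ∃ i, (S i).1 = x} ↑net ∧ IsVorAssign ρ (↑net) v ∧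
    ∀ p ∈ net, ∀ y : Y,
      Nat.card {i : Fin n // v (S i).1 = p ∧ (S i).2 = y} ≤
        Nat.card {i : Fin n // v (S i).1 = p ∧ (S i).2 = lab p}

/-- The set `Γ` of candidate scales for the sample `S`: all nonzero pairwise distances of
sample points. -/
def scaleSet (ρ : X → X → ℝ) {n : ℕ} (S : Fin n → X × Y) : Set ℝ :=
  {γ | γ ≠ 0 ∧ ∃ i j, ρ (S i).1 (S j).1 = γ}

/-- `out` is a possible output of the KSU algorithm run on the sample `S` with confidence `δ`
and generalization bound `Q`: for each scale `γ ∈ Γ` a candidate (a majority-labeled `γ`-net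
`(net γ, lab γ)`, with a 1-NN classifier `hcl γ` of it used to compute the empirical error
`α(γ)`), and the output is the labeled net at a scale `γ* ∈ Γ` minimizing
`Q(n, α(γ), 2κ(γ), δ)` over `γ ∈ Γ`.  (In the degenerate cases: an empty sample yields the
empty set, and a sample whose points all coincide — `Γ = ∅` — yields that single point with
an empirical majority label.) -/
def IsKSUOutput (ρ : X → X → ℝ) (Q : ℕ → ℝ → ℕ → ℝ → ℝ) (δ : ℝ) {n : ℕ}
    (S : Fin n → X × Y) (out : Finset (X × Y)) : Prop :=
  (n = 0 ∧ out = ∅) ∨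
  (n ≠ 0 ∧ scaleSet ρ S = ∅ ∧
    ∃ (x₀ : X) (y : Y), (∃ i, (S i).1 = x₀) ∧
      (∀ y' : Y, Nat.card {i : Fin n // (S i).2 = y'} ≤ Nat.card {i : Fin n // (S i).2 = y}) ∧
      out = {(x₀, y)}) ∨
  (∃ (net : ℝ → Finset X) (v : ℝ → X → X) (lab : ℝ → X → Y) (hcl : ℝ → X → Y) (γs : ℝ),
    (∀ γ ∈ scaleSet ρ S, IsKSUCand ρ S γ (net γ) (v γ) (lab γ) ∧
      Is1NN ρ (Finset.image (fun p => (p, lab γ p)) (net γ)) (hcl γ)) ∧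
    γs ∈ scaleSet ρ S ∧
    (∀ γ ∈ scaleSet ρ S,
      Q n (empErr (hcl γs) S) (2 * (net γs).card) δ ≤
        Q n (empErr (hcl γ) S) (2 * (net γ).card) δ) ∧
    out = Finset.image (fun p => (p, lab γs p)) (net γs))

end KSU

/-- A finite labeled set is compressible to twice its size as soon as each of its points and each
of its labels occurs in the sample. -/
theorem isCRepr_of_forall_mem {X Y : Type*} {n : ℕ} (S : Fin n → X × Y) (S' : Finset (X × Y))
    (hS' : ∀ q ∈ S', ∃ i i' : Fin n, (S i).1 = q.1 ∧ (S i').2 = q.2) :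
    IsCRepr S (2 * S'.card) S' := by
  choose! i i' hi hi' using fun q : S' => hS' q q.2
  let e := S'.equivFin.symm
  refine ⟨S'.card, fun j => i (e j), fun j => i' (e j), rfl, ?_⟩
  ext q
  simp only [Finset.mem_image, Finset.mem_univ, true_and, hi, hi', Prod.mk.eta]
  constructor
  · intro hq
    exact ⟨e.symm ⟨q, hq⟩, by simp⟩
  · rintro ⟨j, rfl⟩
    exact (e j).2

/-- A Voronoi assignment fixes its anchors. -/
theorem IsVorAssign.apply_eq_self {X : Type*} [MetricSpace X] {B : Set X} {v : X → X}
    (hv : IsVorAssign dist B v) {p : X} (hp : p ∈ B) : v p = p := by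
  have hbdd : BddBelow (Set.range fun q : B => dist p (q : X)) :=
    ⟨0, by rintro _ ⟨q, rfl⟩; exact dist_nonneg⟩
  have hle : dist p (v p) ≤ 0 := by
    rw [(hv p).2]
    simpa using ciInf_le hbdd ⟨p, hp⟩
  exact (dist_le_zero.mp hle).symm

/-- If some index satisfying `P` has label `y₀`, and `y` occurs at least as often as `y₀` among the
indices satisfying `P`, then `y` is a sample label. -/
theorem exists_label_eq_of_card_le {X Y : Type*} {n : ℕ} {S : Fin n → X × Y} {P : Fin n → Prop}
    {i : Fin n} {y : Y} (hi : P i)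
    (h : Nat.card {j : Fin n // P j ∧ (S j).2 = (S i).2} ≤
      Nat.card {j : Fin n // P j ∧ (S j).2 = y}) :
    ∃ j, (S j).2 = y := by
  have : Nonempty {j : Fin n // P j ∧ (S j).2 = (S i).2} := ⟨⟨i, hi, rfl⟩⟩
  obtain ⟨⟨j, -, hj⟩⟩ := (Nat.card_pos_iff.mp (Nat.card_pos.trans_le h)).1
  exact ⟨j, hj⟩

/-- The mapping `S ↦ S'` computed by the KSU algorithm is a compression
scheme: with the compression function
`𝒞((x̄_1,ȳ_1),…,(x̄_{2m},ȳ_{2m})) = ((x̄_1,ȳ_{m+1}),…,(x̄_m,ȳ_{2m}))`, every output `S'` of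
KSU on a sample `S` equals `𝒞(S(i))` for a suitable index vector `i` of length `2|S'|`;
consequently `S'` is an `(ê, 2|S'|)`-compression of `S`, where `ê` is the empirical error on
`S` of a 1-NN classifier `h` of `S'`. -/
theorem ksu_is_compression_scheme
    {X Y : Type*} [MetricSpace X] [Countable Y]
    (Q : ℕ → ℝ → ℕ → ℝ → ℝ) (δ : ℝ) {n : ℕ} (S : Fin n → X × Y)
    (S' : Finset (X × Y)) (h : X → Y)
    (hout : IsKSUOutput dist Q δ S S') (h1nn : Is1NN dist S' h) :
    IsCRepr S (2 * S'.card) S' ∧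
      ∃ h' : X → Y, Is1NN dist S' h' ∧ empErr h' S ≤ empErr h S := by
  refine ⟨isCRepr_of_forall_mem S S' ?_, h, h1nn, le_rfl⟩
  rcases hout with ⟨-, rfl⟩ | ⟨-, -, x₀, y, ⟨i, hi⟩, hy, rfl⟩ |
    ⟨net, v, lab, hcl, γs, hcand, hγs, -, rfl⟩
  · simp
  · intro q hq
    obtain rfl := Finset.mem_singleton.mp hq
    obtain ⟨j, hj⟩ := exists_label_eq_of_card_le (S := S) (P := fun _ => True) (i := i) (y := y)
      trivial (by simpa only [true_and] using hy (S i).2)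
    exact ⟨i, j, hi, hj⟩
  · intro q hq
    obtain ⟨p, hp, rfl⟩ := Finset.mem_image.mp hq
    obtain ⟨⟨hnet, hvor, hmaj⟩, -⟩ := hcand γs hγs
    obtain ⟨i, hi⟩ := hnet.1 hp
    have hcell : v γs (S i).1 = p := by
      rw [hi]
      exact hvor.apply_eq_self hp
    obtain ⟨j, hj⟩ := exists_label_eq_of_card_le (P := fun j => v γs (S j).1 = p) hcell
      (hmaj p hp (S i).2)
    exact ⟨i, j, hi, hj⟩
end

section
/- Let (X,ρ) be a complete separable metric space of finite doubling dimension, Y a countable label set, and μ̄ a Borel probability measure on X×Y with marginal μ on X and Bayes risk R*. For every ν > 0 there exists β = β(ν) > 0 such that: for every finite measurable partition V = {V_1, V_2, …} of X and every measurable set M ⊆ X satisfying (i) μ(X ∖ M) ≤ ν and (ii) diam(V_i ∩ M) ≤ β for every cell V_i, every true majority-vote classifier h*_{V,M} — i.e., every classifier h constant on each cell V_i with value y maximizing μ̄((V_i ∩ M) × {y}) over y ∈ Y whenever μ(V_i ∩ M) > 0 (arbitrary on cells with μ(V_i ∩ M) = 0) — satisfies err(h*_{V,M}) ≤ R* + 5ν.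 -/
open MeasureTheory Filter Metric Set
open scoped ENNReal NNReal Classical

/-- `(X, ρ)` has finite doubling dimension: there is `n` such that every ball can be covered
by at most `n` balls of half its radius. -/
def HasFiniteDoublingDim (X : Type*) [MetricSpace X] : Prop :=
  ∃ D : ℕ, ∀ (x : X) (r : ℝ), ∃ s : Finset X,
    s.card ≤ D ∧ Metric.ball x r ⊆ ⋃ y ∈ s, Metric.ball y (r / 2)

/-- A measurable map into a countable discrete space is locally constant at a uniform scale on
a compact set of almost full measure. -/
theorem exists_isCompact_locally_constant
    {X Y : Type*} [MetricSpace X] [CompleteSpace X] [TopologicalSpace.SeparableSpace X]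
    [MeasurableSpace X] [BorelSpace X]
    [Countable Y] [MeasurableSpace Y] [MeasurableSingletonClass Y]
    (μ : Measure X) [IsFiniteMeasure μ] {f : X → Y} (hf : Measurable f)
    {ε : ℝ≥0∞} (hε : ε ≠ 0) :
    ∃ K : Set X, IsCompact K ∧ μ Kᶜ ≤ ε ∧
      ∃ δ : ℝ, 0 < δ ∧ ∀ x ∈ K, ∀ x' ∈ K, dist x' x < δ → f x' = f x := by
  have hε2 : ε / 2 ≠ 0 := (ENNReal.half_pos hε).ne'
  obtain ⟨η, hη, hηsum⟩ := ENNReal.exists_pos_sum_of_countable' hε2 Y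
  have hfib (y : Y) : MeasurableSet (f ⁻¹' {y}) := hf (measurableSet_singleton y)
  choose U hfU hUo _ hUη using fun y =>
    (hfib y).exists_isOpen_sdiff_lt (μ := μ) (measure_ne_top μ _) (hη y).ne'
  set B : Set X := ⋃ y, U y \ f ⁻¹' {y}
  have hBm : MeasurableSet B :=
    MeasurableSet.iUnion fun y => (hUo y).measurableSet.diff (hfib y)
  have hμB : μ B ≤ ε / 2 :=
    (measure_iUnion_le _).trans ((ENNReal.tsum_le_tsum fun y => (hUη y).le).trans hηsum.le)
  obtain ⟨K, hKB, hK, hμK⟩ :=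
    hBm.compl.exists_isCompact_sdiff_lt (μ := μ) (measure_ne_top μ _) hε2
  refine ⟨K, hK, ?_, ?_⟩
  · calc μ Kᶜ ≤ μ (B ∪ Bᶜ \ K) := measure_mono fun x hx => by
          by_cases h : x ∈ B
          · exact Or.inl h
          · exact Or.inr ⟨h, hx⟩
      _ ≤ μ B + μ (Bᶜ \ K) := measure_union_le _ _
      _ ≤ ε / 2 + ε / 2 := add_le_add hμB hμK.le
      _ = ε := ENNReal.add_halves ε
  · obtain ⟨δ, hδ, hball⟩ := lebesgue_number_lemma_of_metric hK hUo
      (fun x _ => mem_iUnion.2 ⟨f x, hfU (f x) rfl⟩)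
    have key {x : X} (hx : x ∈ K) {y : Y} (hy : x ∈ U y) : f x = y := by
      by_contra hne
      exact hKB hx (mem_iUnion.2 ⟨y, hy, hne⟩)
    refine ⟨δ, hδ, fun x hx x' hx' hd => ?_⟩
    obtain ⟨y, hy⟩ := hball x hx
    rw [key hx' (hy (mem_ball.2 hd)), key hx (hy (mem_ball_self hδ))]

/-- Among constant labels, a label of maximal mass on `W` has minimal error on `W`. -/
theorem measure_ne_le_of_measure_prod_singleton_le
    {X Y : Type*} [MeasurableSpace X] [MeasurableSpace Y] [MeasurableSingletonClass Y]
    (μ : Measure (X × Y)) [IsFiniteMeasure μ] {W : Set X} (hW : MeasurableSet W) {y z : Y}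
    (h : μ (W ×ˢ {z}) ≤ μ (W ×ˢ {y})) :
    μ (W ×ˢ {y}ᶜ) ≤ μ (W ×ˢ {z}ᶜ) := by
  have hc (t : Y) : (W ×ˢ {t}ᶜ : Set (X × Y)) = W ×ˢ univ \ W ×ˢ {t} := by
    ext p
    simp only [mem_prod, mem_compl_iff, mem_singleton_iff, Set.mem_sdiff, mem_univ]
    tauto
  have hd (t : Y) : μ (W ×ˢ {t}ᶜ) = μ (W ×ˢ univ) - μ (W ×ˢ {t}) := by
    rw [hc, measure_sdiff (prod_mono_right (subset_univ _))
      (hW.prod (measurableSet_singleton t)).nullMeasurableSet (measure_ne_top μ _)]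
  rw [hd, hd]
  exact tsub_le_tsub_left h _

/-- Let `(X, ρ)` be a complete separable metric space of finite doubling
dimension, `Y` a countable label set and `μ̄` a Borel probability measure on `X × Y` with
marginal `μ` and Bayes risk `R*`.  For every `ν > 0` there is `β > 0` such that for every
finite measurable partition `V` of `X` and every measurable `M ⊆ X` with
(i) `μ(X ∖ M) ≤ ν` and (ii) `diam(V_i ∩ M) ≤ β` for every cell `V_i`, every true
majority-vote classifier `h` for `(V, M)` — i.e. `h` constant on each cell, with value `y`
maximizing `μ̄((V_i ∩ M) × {y})` whenever `μ(V_i ∩ M) > 0` — satisfies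
`err(h) ≤ R* + 5ν`. -/
theorem true_majority_vote_approximates_bayes
    {X Y : Type*} [MetricSpace X] [CompleteSpace X] [TopologicalSpace.SeparableSpace X]
    [MeasurableSpace X] [BorelSpace X]
    [Countable Y] [MeasurableSpace Y] [MeasurableSingletonClass Y]
    (hdd : HasFiniteDoublingDim X)
    (μb : Measure (X × Y)) [IsProbabilityMeasure μb]
    (ν : ℝ) (hν : 0 < ν) :
    ∃ β : ℝ, 0 < β ∧
      ∀ (V : Finset (Set X)) (M : Set X),
        (∀ s ∈ V, MeasurableSet s) →
        (∀ s ∈ V, ∀ t ∈ V, s ≠ t → Disjoint s t) →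
        (⋃ s ∈ V, s) = Set.univ →
        MeasurableSet M →
        μb.map Prod.fst (Set.univ \ M) ≤ ENNReal.ofReal ν →
        (∀ s ∈ V, EMetric.diam (s ∩ M) ≤ ENNReal.ofReal β) →
        ∀ h : X → Y,
          (∀ s ∈ V, ∃ y : Y, (∀ x ∈ s, h x = y) ∧
            (0 < μb.map Prod.fst (s ∩ M) →
              ∀ y' : Y, μb ((s ∩ M) ×ˢ ({y'} : Set Y)) ≤ μb ((s ∩ M) ×ˢ ({y} : Set Y)))) →
          μb {p : X × Y | h p.1 ≠ p.2} ≤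
            (⨅ f : {f : X → Y // Measurable f}, μb {p : X × Y | f.1 p.1 ≠ p.2}) +
              ENNReal.ofReal (5 * ν) := by
  set R : ℝ≥0∞ := ⨅ f : {f : X → Y // Measurable f}, μb {p : X × Y | f.1 p.1 ≠ p.2}
  by_cases hRtop : R = ⊤
  · exact ⟨1, one_pos, fun V M _ _ _ _ _ _ h _ => by simp [hRtop]⟩
  have hν0 : ENNReal.ofReal ν ≠ 0 := (ENNReal.ofReal_pos.2 hν).ne'
  obtain ⟨⟨f, hf⟩, hfR⟩ : ∃ f : {f : X → Y // Measurable f},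
      μb {p : X × Y | f.1 p.1 ≠ p.2} < R + ENNReal.ofReal ν :=
    iInf_lt_iff.1 (ENNReal.lt_add_right hRtop hν0)
  obtain ⟨K, hK, hμK, δ, hδ, hfK⟩ :=
    exists_isCompact_locally_constant (μb.map Prod.fst) hf hν0
  have hKm : MeasurableSet K := hK.measurableSet
  refine ⟨δ / 2, half_pos hδ, fun V M hVm hVd hVu hM hμM hdiam h hh => ?_⟩
  set B : Set (X × Y) := {p | f p.1 ≠ p.2} ∪ Prod.fst ⁻¹' Kᶜ with hB
  have hBm : MeasurableSet B := by
    have : {p : X × Y | f p.1 ≠ p.2} = ⋃ y, (f ⁻¹' {y}) ×ˢ {y}ᶜ := by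
      ext p
      simp [eq_comm]
    rw [hB, this]
    exact (MeasurableSet.iUnion fun y => (hf (measurableSet_singleton y)).prod
      (measurableSet_singleton y).compl).union (measurable_fst hKm.compl)
  have hcell : ∀ s ∈ V, μb ({p | h p.1 ≠ p.2} ∩ Prod.fst ⁻¹' (s ∩ M)) ≤
      μb (B ∩ Prod.fst ⁻¹' (s ∩ M)) := by
    intro s hs
    have hW : MeasurableSet (s ∩ M) := (hVm s hs).inter hM
    obtain ⟨y, hy, hmax⟩ := hh s hs
    obtain hzero | hpos := eq_zero_or_pos (μb.map Prod.fst (s ∩ M))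
    · rw [Measure.map_apply measurable_fst hW] at hzero
      rw [measure_mono_null inter_subset_right hzero]
      exact zero_le
    obtain ⟨z, hz⟩ : ∃ z, ∀ x ∈ s ∩ M, x ∈ K → f x = z := by
      by_cases hne : ∃ x ∈ s ∩ M, x ∈ K
      · obtain ⟨x, hxW, hxK⟩ := hne
        refine ⟨f x, fun x' hx'W hx'K => hfK x hxK x' hx'K ?_⟩
        have hle := (Metric.edist_le_ediam_of_mem hx'W hxW).trans (hdiam s hs)
        rw [edist_dist, ENNReal.ofReal_le_ofReal_iff (half_pos hδ).le] at hle
        linarith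
      · exact ⟨y, fun x hxW hxK => (hne ⟨x, hxW, hxK⟩).elim⟩
    calc μb ({p | h p.1 ≠ p.2} ∩ Prod.fst ⁻¹' (s ∩ M))
        ≤ μb ((s ∩ M) ×ˢ {y}ᶜ) := measure_mono fun p hp =>
          ⟨hp.2, fun hpy => hp.1 ((hy p.1 hp.2.1).trans (mem_singleton_iff.1 hpy).symm)⟩
      _ ≤ μb ((s ∩ M) ×ˢ {z}ᶜ) :=
          measure_ne_le_of_measure_prod_singleton_le μb hW (hmax hpos z)
      _ ≤ μb (B ∩ Prod.fst ⁻¹' (s ∩ M)) := measure_mono fun p hp => by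
          refine ⟨?_, hp.1⟩
          by_cases hpK : p.1 ∈ K
          · exact Or.inl fun he => hp.2 (he.symm.trans (hz p.1 hp.1 hpK))
          · exact Or.inr hpK
  have hsum : ∑ s ∈ V, μb (B ∩ Prod.fst ⁻¹' (s ∩ M)) ≤ μb B := by
    rw [← measure_biUnion_finset]
    · exact measure_mono (iUnion₂_subset fun s _ => inter_subset_left)
    · intro s hs t ht hst
      exact ((hVd s hs t ht hst).mono inter_subset_left inter_subset_left).preimage Prod.fst
        |>.mono inter_subset_right inter_subset_right
    · exact fun s hs => hBm.inter (measurable_fst ((hVm s hs).inter hM))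
  have hμB : μb B ≤ R + ENNReal.ofReal ν + ENNReal.ofReal ν := by
    refine (measure_union_le _ _).trans (add_le_add hfR.le ?_)
    rwa [← Measure.map_apply measurable_fst hKm.compl]
  have hμMc : μb (Prod.fst ⁻¹' (univ \ M)) ≤ ENNReal.ofReal ν := by
    rwa [← Measure.map_apply measurable_fst (MeasurableSet.univ.diff hM)]
  calc μb {p : X × Y | h p.1 ≠ p.2}
      ≤ μb (Prod.fst ⁻¹' (univ \ M) ∪
          ⋃ s ∈ V, {p | h p.1 ≠ p.2} ∩ Prod.fst ⁻¹' (s ∩ M)) := measure_mono fun p hp => by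
        by_cases hpM : p.1 ∈ M
        · obtain ⟨s, hs, hps⟩ := mem_iUnion₂.1 (hVu.ge (mem_univ p.1))
          exact Or.inr (mem_iUnion₂.2 ⟨s, hs, hp, hps, hpM⟩)
        · exact Or.inl ⟨mem_univ _, hpM⟩
    _ ≤ μb (Prod.fst ⁻¹' (univ \ M)) +
          ∑ s ∈ V, μb ({p | h p.1 ≠ p.2} ∩ Prod.fst ⁻¹' (s ∩ M)) :=
        (measure_union_le _ _).trans (by gcongr; exact measure_biUnion_finset_le _ _)
    _ ≤ ENNReal.ofReal ν + (R + ENNReal.ofReal ν + ENNReal.ofReal ν) :=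
        add_le_add hμMc ((Finset.sum_le_sum hcell).trans (hsum.trans hμB))
    _ = R + ENNReal.ofReal (3 * ν) := by
        rw [show 3 * ν = ν + ν + ν by ring, ENNReal.ofReal_add (by positivity) hν.le,
          ENNReal.ofReal_add hν.le hν.le]
        ring
    _ ≤ R + ENNReal.ofReal (5 * ν) := by
        gcongr
        norm_num
end
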